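/- Let A and B be closable subgroups of a group Γ, and suppose that A ≤ B ≤ clo(A). Then clo(B) = clo(A). -/

import Mathlib

/-- The rank of a subgroup, as an extended natural number: the minimal cardinality of a
finite generating set, or `⊤` if the subgroup is not finitely generated. -/
noncomputable def subgroupRank {Γ : Type*} [Group Γ] (H : Subgroup Γ) : ℕ∞ :=
  ⨅ (S : Finset Γ) (_ : Subgroup.closure (S : Set Γ) = H), (S.card : ℕ∞)

/-- `A` has local rank at most `r` if every finitely generated subgroup of `A` is contained
in a subgroup of `A` of rank at most `r`. -/
def LocalRankLE {Γ : Type*} [Group Γ] (A : Subgroup Γ) (r : ℕ) : Prop :=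
  ∀ B : Subgroup Γ, B ≤ A → B.FG →
    ∃ C : Subgroup Γ, C ≤ A ∧ B ≤ C ∧ subgroupRank C ≤ (r : ℕ∞)

/-- The local rank of a subgroup: the least `r` such that `LocalRankLE A r`, or `⊤` if
there is no such `r`. -/
noncomputable def localRank {Γ : Type*} [Group Γ] (A : Subgroup Γ) : ℕ∞ :=
  ⨅ (r : ℕ) (_ : LocalRankLE A r), (r : ℕ∞)

/-- A group is `k`-free if every subgroup of rank at most `k` is free. -/
def KFree (Γ : Type*) [Group Γ] (k : ℕ) : Prop :=
  ∀ H : Subgroup Γ, subgroupRank H ≤ (k : ℕ∞) → IsFreeGroup H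

/-- The index of freedom of `Γ`: the supremum of all `k` such that `Γ` is `k`-free. -/
noncomputable def iof (Γ : Type*) [Group Γ] : ℕ∞ :=
  ⨆ (k : ℕ) (_ : KFree Γ k), (k : ℕ∞)

/-- A subgroup `A` of `Γ` is strongly closable if `localRank A < iof Γ`. -/
def StronglyClosable {Γ : Type*} [Group Γ] (A : Subgroup Γ) : Prop :=
  localRank A < iof Γ

/-- A subgroup `A` of `Γ` is closable if it has finite local rank and there is some `z ∈ Γ`
with `localRank ⟨A, z⟩ < iof Γ`. -/
def Closable {Γ : Type*} [Group Γ] (A : Subgroup Γ) : Prop :=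
  localRank A < ⊤ ∧ ∃ z : Γ, localRank (A ⊔ Subgroup.closure {z}) < iof Γ

/-- An element `x` of `Γ` is `A`-admissible if `⟨A, x⟩` is strongly closable and
`localRank ⟨A, x⟩ ≤ localRank A`. -/
def Admissible {Γ : Type*} [Group Γ] (A : Subgroup Γ) (x : Γ) : Prop :=
  StronglyClosable (A ⊔ Subgroup.closure {x}) ∧
    localRank (A ⊔ Subgroup.closure {x}) ≤ localRank A

/-- A sequence `x₁, …, x_m` is `A`-admissible if each `x_i` is `⟨A, x₁, …, x_{i-1}⟩`-admissible. -/
def AdmissibleSeq {Γ : Type*} [Group Γ] : Subgroup Γ → List Γ → Prop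
  | _, [] => True
  | A, x :: xs => Admissible A x ∧ AdmissibleSeq (A ⊔ Subgroup.closure {x}) xs

/-- `clo A` is the set of all `x ∈ Γ` which occur as the last term of an `A`-admissible
sequence. -/
def clo {Γ : Type*} [Group Γ] (A : Subgroup Γ) : Set Γ :=
  { x | ∃ l : List Γ, AdmissibleSeq A (l ++ [x]) }

/-- The homomorphism `ι_{A,x}` from the free product `A ∗ ⟨t⟩` to `Γ` restricting to the
inclusion on `A` and sending `t` to `x`. -/
noncomputable def iotaAX {Γ : Type*} [Group Γ] (A : Subgroup Γ) (x : Γ) :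
    Monoid.Coprod (↥A) (Multiplicative ℤ) →* Γ :=
  Monoid.Coprod.lift A.subtype (zpowersHom Γ x)

/-- Elements `g 0, …, g (m-1)` of `Γ` are independent if they freely generate a free subgroup,
i.e. the induced homomorphism from the free group on `m` generators is injective. -/
def Independent {Γ : Type*} [Group Γ] {m : ℕ} (g : Fin m → Γ) : Prop :=
  Function.Injective (FreeGroup.lift g : FreeGroup (Fin m) →* Γ)

theorem freeGroup_resFin {ι : Type*} (w : FreeGroup ι) (hw : w ≠ 1) :
    ∃ (X : Finset (FreeGroup ι)) (q : FreeGroup ι →* Equiv.Perm X), q w ≠ 1 := by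
  classical
  obtain ⟨L, rfl⟩ : ∃ L, FreeGroup.mk L = w := ⟨w.toWord, FreeGroup.mk_toWord⟩
  let X : Finset (FreeGroup ι) := (L.tails.map FreeGroup.mk).toFinset
  have hX : ∀ s, s <:+ L → FreeGroup.mk s ∈ X := by
    intro s hs
    simp only [X, List.mem_toFinset, List.mem_map, List.mem_tails]
    exact ⟨s, hs, rfl⟩
  have hσ : ∀ a : ι, ∃ σ : Equiv.Perm X, ∀ x : X, ∀ y : X,
      FreeGroup.of a * (x : FreeGroup ι) = y → σ x = y := by
    intro a
    let e : {x : X // FreeGroup.of a * (x : FreeGroup ι) ∈ X} ≃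
        {x : X // (FreeGroup.of a)⁻¹ * (x : FreeGroup ι) ∈ X} :=
      { toFun := fun x => ⟨⟨FreeGroup.of a * (x.1 : FreeGroup ι), x.2⟩, by simp⟩
        invFun := fun x => ⟨⟨(FreeGroup.of a)⁻¹ * (x.1 : FreeGroup ι), x.2⟩, by simp⟩
        left_inv := fun x => by simp
        right_inv := fun x => by simp }
    refine ⟨e.extendSubtype, fun x y hxy => ?_⟩
    rw [Equiv.extendSubtype_apply_of_mem e x (by rw [hxy]; exact y.2)]
    exact Subtype.ext hxy
  choose σ hσ using hσ
  refine ⟨X, FreeGroup.lift σ, fun h1 => hw ?_⟩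
  have key : ∀ s (hs : s <:+ L), FreeGroup.lift σ (FreeGroup.mk s) ⟨1, hX [] (List.nil_suffix)⟩
      = ⟨FreeGroup.mk s, hX s hs⟩ := by
    intro s
    induction s with
    | nil => intro hs; rfl
    | cons p s ih =>
      intro hs
      have hs' : s <:+ L := (List.suffix_cons p s).trans hs
      have h := ih hs'
      obtain ⟨a, b⟩ := p
      have hm : (FreeGroup.mk ((a, b) :: s) : FreeGroup ι)
        = FreeGroup.mk [(a, b)] * FreeGroup.mk s := by simp [FreeGroup.mul_mk]
      have hm2 : FreeGroup.lift σ (FreeGroup.mk ((a, b) :: s))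
        = FreeGroup.lift σ (FreeGroup.mk [(a, b)]) * FreeGroup.lift σ (FreeGroup.mk s) := by
        rw [hm, map_mul]
      rw [hm2, Equiv.Perm.mul_apply, h]
      cases b with
      | true =>
        have : FreeGroup.lift σ (FreeGroup.mk [(a, true)]) = σ a := FreeGroup.lift_apply_of
        rw [this]
        exact hσ a _ _ hm.symm
      | false =>
        have h2 : (FreeGroup.mk [(a, false)] : FreeGroup ι) = (FreeGroup.of a)⁻¹ := by
          simp [FreeGroup.of, FreeGroup.inv_mk, FreeGroup.invRev]
        rw [h2, map_inv, FreeGroup.lift_apply_of, Equiv.Perm.inv_eq_iff_eq, eq_comm]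
        apply hσ
        show _ * FreeGroup.mk _ = FreeGroup.mk _
        rw [hm, h2]; simp
  have h2 := key L (List.suffix_refl L)
  rw [h1] at h2
  exact (congrArg Subtype.val h2).symm

theorem hopf_free {ι κ : Type*} [Finite ι] (f : FreeGroup ι →* FreeGroup κ)
    (hf : Function.Surjective f) (hni : ¬ Function.Injective f) :
    Finite κ ∧ Nat.card κ < Nat.card ι := by
  classical
  have inj : ∀ (Q : Type _) [Group Q], Function.Injective
      (fun φ : κ → Q => FreeGroup.lift.symm ((FreeGroup.lift φ).comp f)) := by
    intro Q _ φ ψ h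
    have h' := FreeGroup.lift.symm.injective h
    exact FreeGroup.lift.injective ((MonoidHom.cancel_right hf).1 h')
  have fin : Finite κ := by
    have h := Finite.of_injective _ (inj (ULift (Multiplicative (ZMod 2))))
    by_contra hκ
    rw [not_finite_iff_infinite] at hκ
    exact not_finite_iff_infinite.2 (Pi.infinite_of_left (ι := κ)
      (π := fun _ => ULift (Multiplicative (ZMod 2)))) h
  refine ⟨fin, ?_⟩
  rw [injective_iff_map_eq_one] at hni
  push Not at hni
  obtain ⟨w, hw1, hw⟩ := hni
  obtain ⟨X, q, hq⟩ := freeGroup_resFin w hw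
  by_contra hlt
  have hle : Nat.card ι ≤ Nat.card κ := not_lt.1 hlt
  have hc : Nat.card (ι → Equiv.Perm X) ≤ Nat.card (κ → Equiv.Perm X) := by
    rw [Nat.card_fun, Nat.card_fun]
    exact Nat.pow_le_pow_right Nat.card_pos hle
  have hb := (Nat.bijective_iff_injective_and_card _).2
    ⟨inj (Equiv.Perm X), le_antisymm (Nat.card_le_card_of_injective _ (inj _)) hc⟩
  obtain ⟨φ, hφ⟩ := hb.2 (FreeGroup.lift.symm q)
  have h3 := FreeGroup.lift.symm.injective hφ
  apply hq
  rw [← h3]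
  simp [hw1]

theorem subgroupRank_le_iff {Γ : Type*} [Group Γ] (H : Subgroup Γ) (n : ℕ) :
    subgroupRank H ≤ (n : ℕ∞) ↔
      ∃ S : Finset Γ, Subgroup.closure (S : Set Γ) = H ∧ S.card ≤ n := by
  unfold subgroupRank
  constructor
  · intro h
    have h2 : (⨅ (S : Finset Γ) (_ : Subgroup.closure (S : Set Γ) = H), (S.card : ℕ∞))
      < ((n + 1 : ℕ) : ℕ∞) := lt_of_le_of_lt h (by exact_mod_cast Nat.lt_succ_self n)
    simp only [iInf_lt_iff] at h2
    obtain ⟨S, hS, hc⟩ := h2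
    exact ⟨S, hS, Nat.lt_succ_iff.1 (by exact_mod_cast hc)⟩
  · rintro ⟨S, hS, hc⟩
    exact (iInf₂_le S hS).trans (by exact_mod_cast hc)

theorem LocalRankLE.mono {Γ : Type*} [Group Γ] {A : Subgroup Γ} {m n : ℕ} (h : LocalRankLE A m)
    (hmn : m ≤ n) : LocalRankLE A n := fun B hB hf => by
  obtain ⟨C, h1, h2, h3⟩ := h B hB hf
  exact ⟨C, h1, h2, h3.trans (by exact_mod_cast hmn)⟩

theorem localRank_le_iff {Γ : Type*} [Group Γ] (A : Subgroup Γ) (n : ℕ) :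
    localRank A ≤ (n : ℕ∞) ↔ LocalRankLE A n := by
  unfold localRank
  constructor
  · intro h
    have h2 : (⨅ (r : ℕ) (_ : LocalRankLE A r), (r : ℕ∞))
      < ((n + 1 : ℕ) : ℕ∞) := lt_of_le_of_lt h (by exact_mod_cast Nat.lt_succ_self n)
    simp only [iInf_lt_iff] at h2
    obtain ⟨S, hS, hc⟩ := h2
    exact hS.mono (Nat.lt_succ_iff.1 (by exact_mod_cast hc))
  · intro h
    exact iInf₂_le n h

theorem kfree_of_lt {Γ : Type*} [Group Γ] {n : ℕ} (h : (n : ℕ∞) < iof Γ) : KFree Γ (n + 1) := by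
  unfold iof at h
  simp only [lt_iSup_iff] at h
  obtain ⟨k, hk, hnk⟩ := h
  intro H hH
  have : n + 1 ≤ k := by exact_mod_cast hnk
  exact hk H (hH.trans (by exact_mod_cast this))

/-- Noninjective surjection onto a free subgroup. -/
theorem rank_lt_of_not_inj {Γ : Type*} [Group Γ] {ι : Type*} [Finite ι] (H : Subgroup Γ)
    (hH : IsFreeGroup H) (f : FreeGroup ι →* Γ) (hf : f.range = H)
    (hni : ∃ w, w ≠ 1 ∧ f w = 1) :
    ∃ S : Finset Γ, Subgroup.closure (S : Set Γ) = H ∧ S.card < Nat.card ι := by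
  classical
  subst hf
  let e := IsFreeGroup.toFreeGroup f.range
  have := hopf_free (e.toMonoidHom.comp f.rangeRestrict)
    (e.surjective.comp f.rangeRestrict_surjective) (by
      intro hi
      obtain ⟨w, hw, hw1⟩ := hni
      apply hw
      apply hi
      have : f.rangeRestrict w = 1 := Subtype.ext hw1
      simp [this])
  obtain ⟨hfin, hc⟩ := this
  have := Fintype.ofFinite (IsFreeGroup.Generators f.range)
  let g : IsFreeGroup.Generators f.range → Γ := fun i => (e.symm (FreeGroup.of i) : f.range)
  refine ⟨Finset.univ.image g, ?_, ?_⟩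
  · have h1 : (FreeGroup.lift g) = f.range.subtype.comp e.symm.toMonoidHom := by
      ext i; simp [g]
    rw [Finset.coe_image, Finset.coe_univ, Set.image_univ, ← FreeGroup.range_lift_eq_closure, h1,
      MonoidHom.range_comp]
    have : e.symm.toMonoidHom.range = ⊤ := MonoidHom.range_eq_top.2 e.symm.surjective
    rw [this, ← MonoidHom.range_eq_map, Subgroup.range_subtype]
  · refine lt_of_le_of_lt Finset.card_image_le ?_
    rwa [Finset.card_univ, ← Nat.card_eq_fintype_card]

def fam {Γ : Type*} [Group Γ] (A : Subgroup Γ) (x : Γ) (b : Bool) :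
    Subgroup (Γ × Multiplicative ℤ) :=
  cond b (A.prod ⊥) (Subgroup.zpowers (x, Multiplicative.ofAdd 1))

abbrev FP {Γ : Type*} [Group Γ] (A : Subgroup Γ) (x : Γ) : Type _ :=
  Monoid.CoprodI (fun b => fam A x b)

def iot {Γ : Type*} [Group Γ] (A : Subgroup Γ) (x : Γ) : FP A x →* Γ :=
  Monoid.CoprodI.lift fun b => (MonoidHom.fst _ _).comp (fam A x b).subtype

def Dep {Γ : Type*} [Group Γ] (A : Subgroup Γ) (x : Γ) : Prop :=
  ∃ w : FP A x, w ≠ 1 ∧ iot A x w = 1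

section
variable {Γ : Type*} [Group Γ]

theorem fgBot : (⊥ : Subgroup Γ).FG := ⟨∅, by simp⟩

theorem fam_mono {A B : Subgroup Γ} (h : A ≤ B) (x : Γ) (b : Bool) : fam A x b ≤ fam B x b := by
  cases b
  · exact le_rfl
  · exact Subgroup.prod_mono h le_rfl

def incl {A B : Subgroup Γ} (h : A ≤ B) (x : Γ) : FP A x →* FP B x :=
  Monoid.CoprodI.lift fun b => (Monoid.CoprodI.of (i := b)).comp
    (Subgroup.inclusion (fam_mono h x b))

theorem iot_incl {A B : Subgroup Γ} (h : A ≤ B) (x : Γ) (w : FP A x) :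
    iot B x (incl h x w) = iot A x w := by
  have : (iot B x).comp (incl h x) = iot A x := by
    ext b m; simp [iot, incl]
  exact DFunLike.congr_fun this w

theorem incl_incl {A B C : Subgroup Γ} (h : A ≤ B) (h' : B ≤ C) (x : Γ) (w : FP A x) :
    incl h' x (incl h x w) = incl (h.trans h') x w := by
  have : (incl h' x).comp (incl h x) = incl (h.trans h') x := by
    ext b m; simp only [incl, MonoidHom.comp_apply, Monoid.CoprodI.lift_of]; rfl
  exact DFunLike.congr_fun this w

theorem incl_eq_one {A B : Subgroup Γ} (h : A ≤ B) (x : Γ) (w : FP A x)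
    (hw : incl h x w = 1) : w = 1 := by
  classical
  obtain ⟨u, rfl⟩ : ∃ u : Monoid.CoprodI.Word (fun b => fam A x b), u.prod = w :=
    ⟨Monoid.CoprodI.Word.equiv w, Monoid.CoprodI.Word.equiv.symm_apply_apply w⟩
  let φ : (Σ b, fam A x b) → (Σ b, fam B x b) :=
    fun p => ⟨p.1, Subgroup.inclusion (fam_mono h x p.1) p.2⟩
  let v : Monoid.CoprodI.Word (fun b => fam B x b) :=
    { toList := u.toList.map φ
      ne_one := by
        intro l hl
        simp only [List.mem_map] at hl
        obtain ⟨p, hp, rfl⟩ := hl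
        intro h1
        apply u.ne_one p hp
        have := congrArg Subtype.val h1
        exact Subtype.ext this
      chain_ne := by
        rw [List.isChain_map]
        exact u.chain_ne }
  have hv : v.prod = incl h x u.prod := by
    simp only [Monoid.CoprodI.Word.prod, map_list_prod, v, List.map_map]
    congr 1
  rw [hw, ← Monoid.CoprodI.Word.prod_empty] at hv
  have hv' : v = Monoid.CoprodI.Word.empty := Monoid.CoprodI.Word.equiv.symm.injective hv
  have h3 : u.toList.map φ = [] := congrArg Monoid.CoprodI.Word.toList hv'
  have h4 : u.toList = [] := List.map_eq_nil_iff.1 h3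
  simp [Monoid.CoprodI.Word.prod, h4]

theorem Dep.mono {A B : Subgroup Γ} {x : Γ} (h : A ≤ B) (hd : Dep A x) : Dep B x := by
  obtain ⟨w, hw, hw1⟩ := hd
  exact ⟨incl h x w, fun h1 => hw (incl_eq_one h x w h1), by rw [iot_incl, hw1]⟩

theorem descend {A : Subgroup Γ} {x : Γ} (w : FP A x) :
    ∃ (C : Subgroup Γ) (h : C ≤ A) (w' : FP C x), C.FG ∧ incl h x w' = w := by
  induction w using Monoid.CoprodI.induction_on with
  | one => exact ⟨⊥, bot_le, 1, fgBot, map_one _⟩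
  | of b m =>
    cases b with
    | false =>
      exact ⟨⊥, bot_le, Monoid.CoprodI.of (i := false) m, fgBot, by
        simp only [incl, Monoid.CoprodI.lift_of]; rfl⟩
    | true =>
      obtain ⟨⟨a, t⟩, ha, ht⟩ := m
      refine ⟨Subgroup.closure {a}, (Subgroup.closure_le _).2 (by simpa using ha),
        Monoid.CoprodI.of (i := true) ⟨(a, t), Subgroup.subset_closure rfl, ht⟩,
        ⟨{a}, by simp⟩, by simp only [incl, Monoid.CoprodI.lift_of]; rfl⟩
  | mul u v hu hv =>
    obtain ⟨C, hC, u', hCf, rfl⟩ := hu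
    obtain ⟨D, hD, v', hDf, rfl⟩ := hv
    refine ⟨C ⊔ D, sup_le hC hD, incl le_sup_left x u' * incl le_sup_right x v', hCf.sup hDf, ?_⟩
    rw [map_mul, incl_incl, incl_incl]

theorem Dep.exists_fg {A : Subgroup Γ} {x : Γ} (hd : Dep A x) :
    ∃ C : Subgroup Γ, C ≤ A ∧ C.FG ∧ Dep C x := by
  obtain ⟨w, hw, hw1⟩ := hd
  obtain ⟨C, h, w', hf, rfl⟩ := descend w
  exact ⟨C, h, hf, w', fun h1 => hw (by rw [h1, map_one]), by rw [← iot_incl h, hw1]⟩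

theorem range_iot (A : Subgroup Γ) (x : Γ) : (iot A x).range = A ⊔ Subgroup.closure {x} := by
  rw [iot, Monoid.CoprodI.range_eq_iSup, iSup_bool_eq]
  congr 1
  · ext a
    simp only [MonoidHom.mem_range]
    constructor
    · rintro ⟨⟨m, hm⟩, rfl⟩
      exact hm.1
    · intro ha
      exact ⟨⟨(a, 1), ha, rfl⟩, rfl⟩
  · rw [MonoidHom.range_comp, Subgroup.range_subtype, ← Subgroup.zpowers_eq_closure]
    show Subgroup.map _ (Subgroup.zpowers _) = _
    rw [MonoidHom.map_zpowers]; rfl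

theorem descend_fg {A D : Subgroup Γ} {x : Γ} (hD : D.FG) (h : D ≤ A ⊔ Subgroup.closure {x}) :
    ∃ C : Subgroup Γ, C ≤ A ∧ C.FG ∧ D ≤ C ⊔ Subgroup.closure {x} := by
  classical
  obtain ⟨T, rfl⟩ := hD
  induction T using Finset.induction_on with
  | empty => exact ⟨⊥, bot_le, fgBot, by simp⟩
  | insert a T ha ih =>
    rw [Subgroup.closure_le, Finset.coe_insert, Set.insert_subset_iff] at h
    obtain ⟨C, hC, hf, hT⟩ := ih ((Subgroup.closure_le _).2 h.2)
    have ha : a ∈ (iot A x).range := by rw [range_iot]; exact h.1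
    obtain ⟨w, hw⟩ := ha
    obtain ⟨E, hE, w', hEf, rfl⟩ := descend w
    refine ⟨C ⊔ E, sup_le hC hE, hf.sup hEf, ?_⟩
    rw [Subgroup.closure_le, Finset.coe_insert, Set.insert_subset_iff]
    constructor
    · have : a ∈ E ⊔ Subgroup.closure {x} := by
        rw [← range_iot, ← hw, iot_incl]; exact ⟨_, rfl⟩
      exact (sup_le_sup_right le_sup_right _ : E ⊔ Subgroup.closure {x} ≤ C ⊔ E ⊔ _) this
    · intro t ht
      exact (sup_le_sup_right le_sup_left _ : C ⊔ Subgroup.closure {x} ≤ C ⊔ E ⊔ _) (hT (Subgroup.subset_closure ht))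

theorem exists_cover (S : Finset Γ) (x : Γ) :
    ∃ f : FreeGroup (Option S) →* FP (Subgroup.closure (S : Set Γ)) x,
      Function.Surjective f := by
  let g : Option S → FP (Subgroup.closure (S : Set Γ)) x := fun o => match o with
    | none => Monoid.CoprodI.of (i := false) ⟨(x, Multiplicative.ofAdd 1),
        Subgroup.mem_zpowers _⟩
    | some s => Monoid.CoprodI.of (i := true) ⟨(s, 1), Subgroup.subset_closure s.2, rfl⟩
  refine ⟨FreeGroup.lift g, ?_⟩
  rw [← MonoidHom.range_eq_top, eq_top_iff]
  rintro w -
  induction w using Monoid.CoprodI.induction_on with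
  | one => exact one_mem _
  | mul u v hu hv => exact mul_mem hu hv
  | of b m =>
    cases b with
    | false =>
      obtain ⟨m, hm⟩ := m
      obtain ⟨k, rfl⟩ := Subgroup.mem_zpowers_iff.1 hm
      refine ⟨FreeGroup.of none ^ k, ?_⟩
      rw [map_zpow, FreeGroup.lift_apply_of]
      show (Monoid.CoprodI.of (i := false) _) ^ k = _
      rw [← map_zpow]; rfl
    | true =>
      obtain ⟨⟨a, t⟩, ha, ht⟩ := m
      have ht' : t = 1 := ht
      subst ht'
      have key : ∀ a (ha : a ∈ Subgroup.closure (S : Set Γ)),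
          (Monoid.CoprodI.of (i := true) ⟨(a, 1), ha, rfl⟩ :
            FP (Subgroup.closure (S : Set Γ)) x) ∈ (FreeGroup.lift g).range := by
        intro a ha
        induction ha using Subgroup.closure_induction with
        | mem s hs => exact ⟨FreeGroup.of (some ⟨s, hs⟩), FreeGroup.lift_apply_of⟩
        | one =>
          convert one_mem (FreeGroup.lift g).range
          exact map_one (Monoid.CoprodI.of (i := true) (M := fun b => fam (Subgroup.closure (S : Set Γ)) x b))
        | mul y z hy hz h1 h2 =>
          convert mul_mem h1 h2
          rw [← map_mul]
          rfl
        | inv y hy h1 =>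
          convert inv_mem h1
          rw [← map_inv]
          rfl
      exact key a ha

theorem StronglyClosable.admissible_of_dep {B : Subgroup Γ} {x : Γ} (hB : StronglyClosable B)
    (hd : Dep B x) : Admissible B x := by
  classical
  suffices h : localRank (B ⊔ Subgroup.closure {x}) ≤ localRank B from ⟨lt_of_le_of_lt h hB, h⟩
  obtain ⟨r, hr⟩ := ENat.ne_top_iff_exists.1 (ne_top_of_lt hB)
  have hk : KFree Γ (r + 1) := kfree_of_lt (by rw [hr]; exact hB)
  have hBr : LocalRankLE B r := (localRank_le_iff B r).1 hr.ge
  rw [← hr, localRank_le_iff]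
  intro D hD hDf
  obtain ⟨C0, hC0, hC0f, hDC⟩ := descend_fg hDf hD
  obtain ⟨C1, hC1, hC1f, hd1⟩ := hd.exists_fg
  obtain ⟨C, hC, hle, hrk⟩ := hBr (C0 ⊔ C1) (sup_le hC0 hC1) (hC0f.sup hC1f)
  refine ⟨C ⊔ Subgroup.closure {x}, sup_le_sup_right hC _,
    hDC.trans (sup_le_sup_right (le_sup_left.trans hle) _), ?_⟩
  obtain ⟨S, rfl, hS⟩ := (subgroupRank_le_iff _ _).1 hrk
  have hd2 : Dep (Subgroup.closure (S : Set Γ)) x := hd1.mono (le_sup_right.trans hle)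
  have hfree : IsFreeGroup (Subgroup.closure (S : Set Γ) ⊔ Subgroup.closure {x} : Subgroup Γ) := by
    apply hk
    rw [subgroupRank_le_iff]
    refine ⟨S ∪ {x}, ?_, (Finset.card_union_le _ _).trans (by simpa using hS)⟩
    rw [Finset.coe_union, Subgroup.closure_union, Finset.coe_singleton]
  obtain ⟨f, hf⟩ := exists_cover S x
  obtain ⟨w, hw, hw1⟩ := hd2
  obtain ⟨u, rfl⟩ := hf w
  obtain ⟨T, hT, hTc⟩ := rank_lt_of_not_inj _ hfree ((iot _ x).comp f)
    (by rw [MonoidHom.range_comp, MonoidHom.range_eq_top.2 hf, ← MonoidHom.range_eq_map,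
      range_iot]) ⟨u, fun h => hw (by rw [h, map_one]), hw1⟩
  rw [subgroupRank_le_iff]
  refine ⟨T, hT, ?_⟩
  have : Nat.card (Option S) = S.card + 1 := by simp
  omega

theorem Admissible.dep {A : Subgroup Γ} {x : Γ} (h : Admissible A x) : Dep A x := by
  classical
  by_contra hd
  have hinj : ∀ u v : FP A x, iot A x u = iot A x v → u = v := by
    have : Function.Injective (iot A x) := by
      rw [injective_iff_map_eq_one]
      intro w hw
      by_contra h1
      exact hd ⟨w, h1, hw⟩
    exact fun u v => @this u v
  obtain ⟨hsc, hle⟩ := h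
  obtain ⟨n, hn⟩ := ENat.ne_top_iff_exists.1 (ne_top_of_lt hsc)
  have hk : KFree Γ (n + 1) := kfree_of_lt (by rw [hn]; exact hsc)
  have hAn : LocalRankLE (A ⊔ Subgroup.closure {x}) n := (localRank_le_iff _ n).1 hn.ge
  let ρ : FP A x →* Γ := Monoid.CoprodI.lift fun b =>
    if b = true then (MonoidHom.fst _ _).comp (fam A x b).subtype else 1
  have hρA : ρ.range ≤ A := by
    apply Monoid.CoprodI.lift_range_le
    intro b
    cases b with
    | false => rintro _ ⟨m, rfl⟩; simp
    | true => rintro _ ⟨m, rfl⟩; exact m.2.1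
  have key : ∀ D : Subgroup Γ, D ≤ A → D.FG → ∃ C : Subgroup Γ, C ≤ A ∧ D ≤ C ∧
      ∃ T : Finset Γ, Subgroup.closure (T : Set Γ) = C ∧ T.card < n := by
    intro D hD hDf
    obtain ⟨C, hC, hDC, hCr⟩ := hAn (D ⊔ Subgroup.closure {x}) (sup_le_sup_right hD _)
      (hDf.sup ⟨{x}, by simp⟩)
    obtain ⟨S, rfl, hS⟩ := (subgroupRank_le_iff _ _).1 hCr
    have hp : ∀ s : S, ∃ w : FP A x, iot A x w = s := by
      intro s
      have : (s : Γ) ∈ (iot A x).range := by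
        rw [range_iot]; exact hC (Subgroup.subset_closure s.2)
      exact this
    choose p hp using hp
    let f0 : FreeGroup S →* FP A x := FreeGroup.lift p
    have hf0 : ∀ c ∈ Subgroup.closure (S : Set Γ), ∃ u, iot A x (f0 u) = c := by
      intro c hc
      rw [FreeGroup.closure_eq_range] at hc
      obtain ⟨u, rfl⟩ := hc
      refine ⟨u, ?_⟩
      have : (iot A x).comp f0 = FreeGroup.lift (fun s : ((S : Set Γ) : Type _) => (s : Γ)) := by
        ext s
        simp only [f0, MonoidHom.comp_apply, FreeGroup.lift_apply_of]
        exact hp s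
      exact DFunLike.congr_fun this u
    have hfree : IsFreeGroup (ρ.comp f0).range := by
      apply hk
      rw [subgroupRank_le_iff]
      refine ⟨Finset.univ.image (fun s : S => ρ (p s)), ?_,
        Finset.card_image_le.trans (by simp; omega)⟩
      have : ρ.comp f0 = FreeGroup.lift (fun s : S => ρ (p s)) := by
        ext s; simp [f0]
      rw [this, FreeGroup.range_lift_eq_closure, Finset.coe_image, Finset.coe_univ, Set.image_univ]
    refine ⟨(ρ.comp f0).range, ?_, ?_, ?_⟩
    · rintro _ ⟨u, rfl⟩
      exact hρA ⟨_, rfl⟩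
    · intro d hd
      obtain ⟨u, hu⟩ := hf0 d (hDC (Subgroup.mem_sup_left hd))
      have : f0 u = Monoid.CoprodI.of (i := true) ⟨(d, 1), hD hd, rfl⟩ := by
        apply hinj
        rw [hu]
        simp [iot]
      refine ⟨u, ?_⟩
      simp [this, ρ]
    · obtain ⟨u, hu⟩ := hf0 x (hDC (Subgroup.mem_sup_right (Subgroup.subset_closure rfl)))
      have hu2 : f0 u = Monoid.CoprodI.of (i := false) ⟨(x, Multiplicative.ofAdd 1),
          Subgroup.mem_zpowers _⟩ := by
        apply hinj
        rw [hu]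
        simp [iot]
      have hu1 : u ≠ 1 := by
        intro h1
        rw [h1, map_one] at hu2
        have h2 := hu2.symm
        rw [← map_one (Monoid.CoprodI.of (i := false) (M := fun b => fam A x b))] at h2
        have h3 := congrArg (fun m => (Subtype.val m).2) (Monoid.CoprodI.of_injective _ h2)
        have h4 : Multiplicative.ofAdd (1 : ℤ) = Multiplicative.ofAdd 0 := h3
        exact absurd (Multiplicative.ofAdd.injective h4) one_ne_zero
      have hu3 : (ρ.comp f0) u = 1 := by simp [hu2, ρ]
      obtain ⟨T, hT, hTc⟩ := rank_lt_of_not_inj _ hfree (ρ.comp f0) rfl ⟨u, hu1, hu3⟩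
      exact ⟨T, hT, lt_of_lt_of_le hTc (by simpa using hS)⟩
  have hpos : 0 < n := by
    obtain ⟨_, _, _, T, _, hT⟩ := key ⊥ bot_le fgBot
    omega
  have hA : LocalRankLE A (n - 1) := by
    intro D hD hDf
    obtain ⟨C, h1, h2, T, hT, hc⟩ := key D hD hDf
    exact ⟨C, h1, h2, (subgroupRank_le_iff _ _).2 ⟨T, hT, by omega⟩⟩
  rw [← localRank_le_iff] at hA
  have := hle.trans hA
  rw [← hn] at this
  have : n ≤ n - 1 := by exact_mod_cast this
  omega

def DepSeq : Subgroup Γ → List Γ → Prop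
  | _, [] => True
  | A, x :: xs => Dep A x ∧ DepSeq (A ⊔ Subgroup.closure {x}) xs

theorem DepSeq.mono {l : List Γ} : ∀ {A B : Subgroup Γ}, A ≤ B → DepSeq A l → DepSeq B l := by
  induction l with
  | nil => intros; trivial
  | cons x l ih => exact fun h hd => ⟨hd.1.mono h, ih (sup_le_sup_right h _) hd.2⟩

theorem AdmissibleSeq.depSeq {l : List Γ} : ∀ {A : Subgroup Γ}, AdmissibleSeq A l → DepSeq A l := by
  induction l with
  | nil => intros; trivial
  | cons x l ih => exact fun h => ⟨h.1.dep, ih h.2⟩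

theorem DepSeq.admissibleSeq {l : List Γ} : ∀ {A : Subgroup Γ}, StronglyClosable A →
    DepSeq A l → AdmissibleSeq A l := by
  induction l with
  | nil => intros; trivial
  | cons x l ih =>
    intro A hA h
    have := hA.admissible_of_dep h.1
    exact ⟨this, ih this.1 h.2⟩

theorem DepSeq.exists_fg {l : List Γ} : ∀ {A : Subgroup Γ}, DepSeq A l →
    ∃ C : Subgroup Γ, C ≤ A ∧ C.FG ∧ DepSeq C l := by
  induction l with
  | nil => exact fun _ => ⟨⊥, bot_le, fgBot, trivial⟩
  | cons x l ih =>
    intro A h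
    obtain ⟨C, hC, hCf, hd⟩ := h.1.exists_fg
    obtain ⟨D, hD, hDf, hd2⟩ := ih h.2
    obtain ⟨E, hE, hEf, hDE⟩ := descend_fg hDf hD
    exact ⟨C ⊔ E, sup_le hC hE, hCf.sup hEf, hd.mono le_sup_left,
      hd2.mono (hDE.trans (sup_le_sup_right le_sup_right _))⟩

def extend (A : Subgroup Γ) (l : List Γ) : Subgroup Γ :=
  l.foldl (fun A x => A ⊔ Subgroup.closure {x}) A

theorem admissibleSeq_append {l m : List Γ} : ∀ {A : Subgroup Γ},
    AdmissibleSeq A (l ++ m) ↔ AdmissibleSeq A l ∧ AdmissibleSeq (extend A l) m := by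
  induction l with
  | nil => intro A; simp [AdmissibleSeq, extend]
  | cons x l ih =>
    intro A
    simp only [List.cons_append, AdmissibleSeq, ih, and_assoc]
    rfl

theorem le_extend {l : List Γ} : ∀ {A : Subgroup Γ}, A ≤ extend A l := by
  induction l with
  | nil => intro A; exact le_rfl
  | cons x l ih => intro A; exact le_sup_left.trans (ih (A := A ⊔ Subgroup.closure {x}))

theorem AdmissibleSeq.sc {l : List Γ} : ∀ {A : Subgroup Γ}, StronglyClosable A →
    AdmissibleSeq A l → StronglyClosable (extend A l) := by
  induction l with
  | nil => intro A h _; exact h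
  | cons x l ih => intro A h hl; exact ih hl.1.1 hl.2

theorem extend_append {A : Subgroup Γ} {l m : List Γ} :
    extend A (l ++ m) = extend (extend A l) m := by
  simp [extend]

theorem absorb {A : Subgroup Γ} (hA : Closable A) (T : Finset Γ) (hT : (T : Set Γ) ⊆ clo A) :
    ∃ l, AdmissibleSeq A l ∧ StronglyClosable (extend A l) ∧ (T : Set Γ) ⊆ extend A l := by
  classical
  induction T using Finset.induction_on with
  | empty =>
    by_cases h : StronglyClosable A
    · exact ⟨[], trivial, h, by simp⟩
    · obtain ⟨z, hz⟩ := hA.2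
      exact ⟨[z], ⟨⟨hz, (hz.trans_le (not_lt.1 h)).le⟩, trivial⟩, hz, by simp⟩
  | insert t T ht ih =>
    rw [Finset.coe_insert, Set.insert_subset_iff] at hT
    obtain ⟨l, hl, hsc, hTl⟩ := ih hT.2
    obtain ⟨l', hl'⟩ := hT.1
    have h2 : AdmissibleSeq (extend A l) (l' ++ [t]) :=
      (hl'.depSeq.mono le_extend).admissibleSeq hsc
    refine ⟨l ++ (l' ++ [t]), admissibleSeq_append.2 ⟨hl, h2⟩, ?_, ?_⟩
    · rw [extend_append]; exact h2.sc hsc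
    · rw [Finset.coe_insert, Set.insert_subset_iff, extend_append]
      refine ⟨?_, hTl.trans le_extend⟩
      rw [extend_append]
      exact Subgroup.mem_sup_right (Subgroup.subset_closure rfl)

end

/-- If `A` and `B` are closable subgroups of `Γ` with `A ≤ B ≤ clo A`, then
`clo B = clo A`. -/
theorem clo_eq_of_le_clo {Γ : Type*} [Group Γ] (A B : Subgroup Γ)
    (hA : Closable A) (hB : Closable B) (hAB : A ≤ B) (hBclo : (B : Set Γ) ⊆ clo A) :
    clo B = clo A := by
  apply Set.Subset.antisymm
  · rintro x ⟨l, hl⟩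
    obtain ⟨C, hC, ⟨T, rfl⟩, hd⟩ := hl.depSeq.exists_fg
    obtain ⟨m, hm, hsc, hTm⟩ := absorb hA T
      ((Subgroup.subset_closure.trans hC).trans hBclo)
    refine ⟨m ++ l, ?_⟩
    rw [List.append_assoc]
    exact admissibleSeq_append.2
      ⟨hm, (hd.mono ((Subgroup.closure_le _).2 hTm)).admissibleSeq hsc⟩
  · rintro x ⟨l, hl⟩
    obtain ⟨m, hm, hsc, -⟩ := absorb hB ∅ (by simp)
    refine ⟨m ++ l, ?_⟩
    rw [List.append_assoc]
    exact admissibleSeq_append.2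
      ⟨hm, (hl.depSeq.mono (hAB.trans le_extend)).admissibleSeq hsc⟩
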